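/- arXiv:1603.01765 — 6 statements merged into one kernel-verified Lean document; each statement's English description precedes it below -/
import Mathlib

section
/- Let A be an m×n complex matrix and S an m×k complex matrix with SᴴS invertible. Set T = (SᴴS)⁻¹·Sᴴ·A, and suppose T·Tᴴ is invertible; set S′ = A·Tᴴ·(T·Tᴴ)⁻¹ and B = (Sᴴ·A·Aᴴ·S)⁻¹·Sᴴ·S (assuming Sᴴ·A·Aᴴ·S is invertible). Then S′ = A·Aᴴ·S·B; that is, the matrix produced by one full step of alternating least squares equals A·Aᴴ·S·(Sᴴ·A·Aᴴ·S)⁻¹·Sᴴ·S. -/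
open Matrix

theorem als_one_step {m n k : ℕ}
    (A : Matrix (Fin m) (Fin n) ℂ) (S : Matrix (Fin m) (Fin k) ℂ)
    (hS : IsUnit (Sᴴ * S))
    (T : Matrix (Fin k) (Fin n) ℂ) (hT : T = (Sᴴ * S)⁻¹ * Sᴴ * A)
    (hTT : IsUnit (T * Tᴴ))
    (hSA : IsUnit (Sᴴ * A * Aᴴ * S))
    (S' : Matrix (Fin m) (Fin k) ℂ) (hS' : S' = A * Tᴴ * (T * Tᴴ)⁻¹)
    (B : Matrix (Fin k) (Fin k) ℂ) (hB : B = (Sᴴ * A * Aᴴ * S)⁻¹ * (Sᴴ * S)) :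
    S' = A * Aᴴ * S * B := by
  have hSdet := (isUnit_iff_isUnit_det _).mp hS
  have hTH : Tᴴ = Aᴴ * S * (Sᴴ * S)⁻¹ := by
    simp [hT, conjTranspose_nonsing_inv, Matrix.mul_assoc]
  have hGram : T * Tᴴ = (Sᴴ * S)⁻¹ * (Sᴴ * A * Aᴴ * S) * (Sᴴ * S)⁻¹ := by
    rw [hTH, hT]
    simp only [Matrix.mul_assoc]
  have hInv : (T * Tᴴ)⁻¹ = Sᴴ * S * ((Sᴴ * A * Aᴴ * S)⁻¹ * (Sᴴ * S)) := by
    rw [hGram, Matrix.mul_inv_rev, Matrix.mul_inv_rev, nonsing_inv_nonsing_inv _ hSdet]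
  rw [hS', hInv, hTH, hB, ← Matrix.mul_assoc A, ← Matrix.mul_assoc A,
    ← Matrix.mul_assoc _ (Sᴴ * S), nonsing_inv_mul_cancel_right _ _ hSdet]
end

section
/- Let A be an m×n complex matrix and let (Sᵢ) and (Tᵢ) be the alternating least squares iterates: Tᵢ = (SᵢᴴSᵢ)⁻¹·Sᵢᴴ·A and Sᵢ₊₁ = A·Tᵢᴴ·(Tᵢ·Tᵢᴴ)⁻¹ for i = 0, 1, 2, …, starting from an m×k matrix S₀. Assume that for every i the matrices SᵢᴴSᵢ, Tᵢ·Tᵢᴴ, and Sᵢᴴ·A·Aᴴ·Sᵢ are invertible, and define Bᵢ = (Sᵢᴴ·A·Aᴴ·Sᵢ)⁻¹·Sᵢᴴ·Sᵢ. Then for every i ≥ 1, Sᵢ = (A·Aᴴ)^i · S₀ · B₀ · B₁ · B₂ ⋯ B_{i−1}. -/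
open Matrix

/-- One full sweep of alternating least squares, from `S` to `A * Tᴴ * (T * Tᴴ)⁻¹` with
`T = (Sᴴ * S)⁻¹ * Sᴴ * A`, is multiplication by `A * Aᴴ` followed by a change of basis. -/
theorem als_sweep {m n k : Type*} [Fintype m] [Fintype n] [Fintype k] [DecidableEq k]
    (A : Matrix m n ℂ) (S : Matrix m k ℂ) (T : Matrix k n ℂ)
    (hT : T = (Sᴴ * S)⁻¹ * Sᴴ * A) (hS : IsUnit (Sᴴ * S)) :
    A * Tᴴ * (T * Tᴴ)⁻¹ = A * Aᴴ * S * ((Sᴴ * A * Aᴴ * S)⁻¹ * (Sᴴ * S)) := by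
  have hdet : IsUnit (Sᴴ * S).det := (Matrix.isUnit_iff_isUnit_det _).mp hS
  have hTH : Tᴴ = Aᴴ * S * (Sᴴ * S)⁻¹ := by
    rw [hT]
    simp only [conjTranspose_mul, conjTranspose_nonsing_inv, conjTranspose_conjTranspose,
      Matrix.mul_assoc]
  have hTT : T * Tᴴ = (Sᴴ * S)⁻¹ * (Sᴴ * A * Aᴴ * S) * (Sᴴ * S)⁻¹ := by
    rw [hTH, hT]
    simp only [Matrix.mul_assoc]
  rw [hTT, Matrix.mul_inv_rev, Matrix.mul_inv_rev, nonsing_inv_nonsing_inv _ hdet, hTH]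
  generalize (Sᴴ * A * Aᴴ * S)⁻¹ = M
  rw [← Matrix.mul_assoc A, Matrix.mul_assoc (A * (Aᴴ * S)), ← Matrix.mul_assoc (Sᴴ * S)⁻¹,
    nonsing_inv_mul _ hdet, Matrix.one_mul, ← Matrix.mul_assoc A]

theorem als_unrolled {m n k : ℕ}
    (A : Matrix (Fin m) (Fin n) ℂ)
    (S : ℕ → Matrix (Fin m) (Fin k) ℂ) (T : ℕ → Matrix (Fin k) (Fin n) ℂ)
    (hT : ∀ i, T i = ((S i)ᴴ * S i)⁻¹ * (S i)ᴴ * A)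
    (hS : ∀ i, S (i + 1) = A * (T i)ᴴ * (T i * (T i)ᴴ)⁻¹)
    (hSS : ∀ i, IsUnit ((S i)ᴴ * S i))
    (hTT : ∀ i, IsUnit (T i * (T i)ᴴ))
    (hSA : ∀ i, IsUnit ((S i)ᴴ * A * Aᴴ * S i))
    (B : ℕ → Matrix (Fin k) (Fin k) ℂ)
    (hB : ∀ i, B i = ((S i)ᴴ * A * Aᴴ * S i)⁻¹ * ((S i)ᴴ * S i)) :
    ∀ i, 1 ≤ i →
      S i = (A * Aᴴ) ^ i * S 0 * ((List.range i).map B).prod := by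
  intro i _
  have unrolled : ∀ j, S j = (A * Aᴴ) ^ j * S 0 * ((List.range j).map B).prod := by
    intro j
    induction j with
    | zero => simp
    | succ j ih =>
      rw [hS j, als_sweep A (S j) (T j) (hT j) (hSS j), ← hB j, List.range_succ,
        List.map_append, List.prod_append, pow_succ']
      nth_rewrite 1 [ih]
      simp [Matrix.mul_assoc]
  exact unrolled i
end

section
/- Let A be an m×n complex matrix and let (Sᵢ) and (Tᵢ) be the alternating least squares iterates: Tᵢ = (SᵢᴴSᵢ)⁻¹·Sᵢᴴ·A and Sᵢ₊₁ = A·Tᵢᴴ·(Tᵢ·Tᵢᴴ)⁻¹ for i = 0, 1, 2, …, starting from an m×k matrix S₀, and assume that for every i the matrices SᵢᴴSᵢ and Tᵢ·Tᵢᴴ are invertible. Then all of the following ranks are equal to rank(S₀ᴴ·A): for every i ≥ 0, rank(Sᵢᴴ·A) = rank(Tᵢ) = rank(A·Tᵢᴴ) = rank(S₀ᴴ·A), and for every i ≥ 1, rank(Sᵢ) = rank(S₀ᴴ·A). -/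
open Matrix

section RankOfIsUnit

variable {ι κ R : Type*} [Fintype ι] [Fintype κ] [DecidableEq κ]
  [Field R] [PartialOrder R] [StarRing R] [StarOrderedRing R]

/-- A matrix whose Gram matrix is invertible has full column rank. -/
theorem rank_eq_card_of_isUnit_conjTranspose_mul_self {M : Matrix ι κ R}
    (h : IsUnit (Mᴴ * M)) : M.rank = Fintype.card κ := by
  rw [← rank_conjTranspose_mul_self, rank_of_isUnit _ h]

/-- A matrix `M` with `M * Mᴴ` invertible has full row rank. -/
theorem rank_eq_card_of_isUnit_self_mul_conjTranspose {M : Matrix κ ι R}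
    (h : IsUnit (M * Mᴴ)) : M.rank = Fintype.card κ := by
  rw [← rank_self_mul_conjTranspose, rank_of_isUnit _ h]

end RankOfIsUnit

theorem als_ranks_all_equal {m n k : ℕ}
    (A : Matrix (Fin m) (Fin n) ℂ)
    (S : ℕ → Matrix (Fin m) (Fin k) ℂ) (T : ℕ → Matrix (Fin k) (Fin n) ℂ)
    (hT : ∀ i, T i = ((S i)ᴴ * S i)⁻¹ * (S i)ᴴ * A)
    (hS : ∀ i, S (i + 1) = A * (T i)ᴴ * (T i * (T i)ᴴ)⁻¹)
    (hSS : ∀ i, IsUnit ((S i)ᴴ * S i))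
    (hTT : ∀ i, IsUnit (T i * (T i)ᴴ)) :
    (∀ i, ((S i)ᴴ * A).rank = ((S 0)ᴴ * A).rank ∧
        (T i).rank = ((S 0)ᴴ * A).rank ∧
        (A * (T i)ᴴ).rank = ((S 0)ᴴ * A).rank) ∧
    (∀ i, 1 ≤ i → (S i).rank = ((S 0)ᴴ * A).rank) := by
  have rank_S (i : ℕ) : (S i).rank = k := by
    open scoped ComplexOrder in
    simpa using rank_eq_card_of_isUnit_conjTranspose_mul_self (hSS i)
  have rank_T (i : ℕ) : (T i).rank = k := by
    open scoped ComplexOrder in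
    simpa using rank_eq_card_of_isUnit_self_mul_conjTranspose (hTT i)
  have rank_SA (i : ℕ) : ((S i)ᴴ * A).rank = k := by
    refine le_antisymm (rank_le_height _) ?_
    conv_lhs => rw [← rank_T i, hT i, Matrix.mul_assoc]
    exact rank_mul_le_right _ _
  have rank_AT (i : ℕ) : (A * (T i)ᴴ).rank = k := by
    refine le_antisymm (rank_le_width _) ?_
    conv_lhs => rw [← rank_S (i + 1), hS i]
    exact rank_mul_le_left _ _
  simp only [rank_SA, rank_T, rank_AT, rank_S, implies_true, and_self]
end

section
/- Let A be an m×n complex matrix and let (Sᵢ) and (Tᵢ) be the alternating least squares iterates: Tᵢ = (SᵢᴴSᵢ)⁻¹·Sᵢᴴ·A and Sᵢ₊₁ = A·Tᵢᴴ·(Tᵢ·Tᵢᴴ)⁻¹ for i = 0, 1, 2, …, starting from an m×k matrix S₀, and assume that for every i the matrices SᵢᴴSᵢ, Tᵢ·Tᵢᴴ, and Sᵢᴴ·A·Aᴴ·Sᵢ are invertible. Then for every i ≥ 1, the column space of Sᵢ equals the column space of (A·Aᴴ)^i · S₀; that is, the range of the linear map x ↦ Sᵢ·x equals the range of the linear map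 x ↦ ((A·Aᴴ)^i·S₀)·x. -/
open Matrix

/-- Right multiplication by an invertible matrix does not change the column space. -/
theorem range_mulVecLin_mul_of_isUnit {m k : ℕ} (M : Matrix (Fin m) (Fin k) ℂ)
    {U : Matrix (Fin k) (Fin k) ℂ} (hU : IsUnit U) :
    LinearMap.range (M * U).mulVecLin = LinearMap.range M.mulVecLin := by
  rw [Matrix.mulVecLin_mul]
  exact LinearMap.range_comp_of_range_eq_top _
    (LinearMap.range_eq_top.2 (Matrix.mulVec_surjective_iff_isUnit.2 hU))

theorem als_column_space {m n k : ℕ}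
    (A : Matrix (Fin m) (Fin n) ℂ)
    (S : ℕ → Matrix (Fin m) (Fin k) ℂ) (T : ℕ → Matrix (Fin k) (Fin n) ℂ)
    (hT : ∀ i, T i = ((S i)ᴴ * S i)⁻¹ * (S i)ᴴ * A)
    (hS : ∀ i, S (i + 1) = A * (T i)ᴴ * (T i * (T i)ᴴ)⁻¹)
    (hSS : ∀ i, IsUnit ((S i)ᴴ * S i))
    (hTT : ∀ i, IsUnit (T i * (T i)ᴴ))
    (hSA : ∀ i, IsUnit ((S i)ᴴ * A * Aᴴ * S i)) :
    ∀ i, 1 ≤ i →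
      LinearMap.range (S i).mulVecLin =
        LinearMap.range ((A * Aᴴ) ^ i * S 0).mulVecLin := by
  suffices h : ∀ i, ∃ U : Matrix (Fin k) (Fin k) ℂ, IsUnit U ∧ S i = (A * Aᴴ) ^ i * S 0 * U by
    intro i _
    obtain ⟨U, hU, hi⟩ := h i
    rw [hi, range_mulVecLin_mul_of_isUnit _ hU]
  intro i
  induction i with
  | zero => exact ⟨1, isUnit_one, by simp⟩
  | succ i ih =>
    obtain ⟨U, hU, hi⟩ := ih
    refine ⟨U * ((((S i)ᴴ * S i)⁻¹)ᴴ * (T i * (T i)ᴴ)⁻¹), hU.mul (IsUnit.mul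
      (Matrix.isUnit_nonsing_inv_iff.2 (hSS i)).star
      (Matrix.isUnit_nonsing_inv_iff.2 (hTT i))), ?_⟩
    have hTi : (T i)ᴴ = Aᴴ * (S i * (((S i)ᴴ * S i)⁻¹)ᴴ) := by
      conv_lhs => rw [hT i]
      rw [conjTranspose_mul, conjTranspose_mul, conjTranspose_conjTranspose]
    calc S (i + 1) = A * (T i)ᴴ * (T i * (T i)ᴴ)⁻¹ := hS i
      _ = A * Aᴴ * S i * ((((S i)ᴴ * S i)⁻¹)ᴴ * (T i * (T i)ᴴ)⁻¹) := by
        generalize (T i * (T i)ᴴ)⁻¹ = V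
        rw [hTi]
        simp only [Matrix.mul_assoc]
      _ = _ := by
        generalize (((S i)ᴴ * S i)⁻¹)ᴴ * (T i * (T i)ᴴ)⁻¹ = V
        rw [hi, pow_succ']
        simp only [Matrix.mul_assoc]
end

section
/- Let A be an m×n complex matrix and S an m×k complex matrix with SᴴS invertible, and set T = (SᴴS)⁻¹·Sᴴ·A. Then for every m×n complex matrix M whose column space is contained in the column space of S, the spectral norm satisfies ‖S·T − A‖₂ ≤ ‖M − A‖₂; that is, S·T is the best spectral-norm approximation to A among all matrices with column space inside the column space of S. -/
open Matrix

/-- The spectral norm: the operator norm of the associated linear map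
between Euclidean (ℓ²) spaces. -/
noncomputable def specNorm {m n : ℕ} (M : Matrix (Fin m) (Fin n) ℂ) : ℝ :=
  ‖LinearMap.toContinuousLinearMap (Matrix.toEuclideanLin M)‖

open scoped Matrix.Norms.L2Operator

theorem specNorm_eq_l2_opNorm {m n : ℕ} (M : Matrix (Fin m) (Fin n) ℂ) : specNorm M = ‖M‖ :=
  rfl

/-- An orthogonal projection matrix has spectral norm at most one. -/
theorem IsStarProjection.l2_opNorm_le_one {m : Type*} [Fintype m] [DecidableEq m]
    {P : Matrix m m ℂ} (hP : IsStarProjection P) : ‖P‖ ≤ 1 := by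
  have h := l2_opNorm_conjTranspose_mul_self P
  rw [← star_eq_conjTranspose, hP.isSelfAdjoint.star_eq, hP.isIdempotentElem.eq] at h
  nlinarith [norm_nonneg P]

/-- The matrix `S (SᴴS)⁻¹ Sᴴ` is an orthogonal projection. -/
theorem isStarProjection_mul_inv_mul_conjTranspose {m k : Type*} [Fintype m] [Fintype k]
    [DecidableEq k] {S : Matrix m k ℂ} (hS : IsUnit (Sᴴ * S)) :
    IsStarProjection (S * (Sᴴ * S)⁻¹ * Sᴴ) where
  isIdempotentElem := by
    have h := (Matrix.isUnit_iff_isUnit_det _).mp hS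
    calc S * (Sᴴ * S)⁻¹ * Sᴴ * (S * (Sᴴ * S)⁻¹ * Sᴴ)
        = S * ((Sᴴ * S)⁻¹ * (Sᴴ * S)) * (Sᴴ * S)⁻¹ * Sᴴ := by simp only [Matrix.mul_assoc]
      _ = S * (Sᴴ * S)⁻¹ * Sᴴ := by rw [nonsing_inv_mul _ h, Matrix.mul_one]
  isSelfAdjoint := by
    simp [IsSelfAdjoint, star_eq_conjTranspose, conjTranspose_nonsing_inv, Matrix.mul_assoc]

/-- If the column space of `M` lies in that of `S`, then `M` factors through `S`. -/
theorem exists_eq_mul_of_range_mulVecLin_le {m n k : Type*} [Fintype n] [Fintype k]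
    {M : Matrix m n ℂ} {S : Matrix m k ℂ}
    (h : LinearMap.range M.mulVecLin ≤ LinearMap.range S.mulVecLin) :
    ∃ X : Matrix k n ℂ, M = S * X := by
  classical
  choose x hx using fun j => h (LinearMap.mem_range_self M.mulVecLin (Pi.single j 1))
  refine ⟨(Matrix.of x)ᵀ, ?_⟩
  ext i j
  have hij : M i j = (S *ᵥ x j) i := by simpa using (congrFun (hx j) i).symm
  exact hij

theorem spectral_best_in_column_space {m n k : ℕ}
    (A : Matrix (Fin m) (Fin n) ℂ) (S : Matrix (Fin m) (Fin k) ℂ)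
    (hS : IsUnit (Sᴴ * S))
    (T : Matrix (Fin k) (Fin n) ℂ) (hT : T = (Sᴴ * S)⁻¹ * Sᴴ * A) :
    ∀ M : Matrix (Fin m) (Fin n) ℂ,
      (LinearMap.range M.mulVecLin : Submodule ℂ (Fin m → ℂ)) ≤
          LinearMap.range S.mulVecLin →
        specNorm (S * T - A) ≤ specNorm (M - A) := by
  intro M hM
  obtain ⟨X, rfl⟩ := exists_eq_mul_of_range_mulVecLin_le hM
  have hdet := (Matrix.isUnit_iff_isUnit_det _).mp hS
  have hfix : S * (Sᴴ * S)⁻¹ * Sᴴ * S = S := by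
    rw [Matrix.mul_assoc, Matrix.mul_assoc, nonsing_inv_mul _ hdet, Matrix.mul_one]
  have key : S * T - A = (1 - S * (Sᴴ * S)⁻¹ * Sᴴ) * (S * X - A) := by
    rw [Matrix.sub_mul, Matrix.one_mul, Matrix.mul_sub, ← Matrix.mul_assoc _ S X, hfix, hT]
    simp only [Matrix.mul_assoc]
    abel
  rw [specNorm_eq_l2_opNorm, specNorm_eq_l2_opNorm, key]
  exact (l2_opNorm_mul _ _).trans (mul_le_of_le_one_left (norm_nonneg _)
    (isStarProjection_mul_inv_mul_conjTranspose hS).one_sub.l2_opNorm_le_one)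
end

section
/- Let A be an m×n complex matrix and let (Sᵢ) and (Tᵢ) be the alternating least squares iterates: Tᵢ = (SᵢᴴSᵢ)⁻¹·Sᵢᴴ·A and Sᵢ₊₁ = A·Tᵢᴴ·(Tᵢ·Tᵢᴴ)⁻¹, starting from an m×k matrix S₀, with SᵢᴴSᵢ, Tᵢ·Tᵢᴴ, and Sᵢᴴ·A·Aᴴ·Sᵢ invertible for all i. Then for every i ≥ 1, the column space of Sᵢ is contained in the column space of (A·Aᴴ)^i · S₀, and rank(Sᵢ) = rank((A·Aᴴ)^i · S₀). -/
open Matrix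

/-- Each iterate is, up to an invertible right factor, the start matrix hit by a power of `A * Aᴴ`. -/
theorem als_exists_isUnit_right_factor {m n k : ℕ}
    (A : Matrix (Fin m) (Fin n) ℂ)
    (S : ℕ → Matrix (Fin m) (Fin k) ℂ) (T : ℕ → Matrix (Fin k) (Fin n) ℂ)
    (hT : ∀ i, T i = ((S i)ᴴ * S i)⁻¹ * (S i)ᴴ * A)
    (hS : ∀ i, S (i + 1) = A * (T i)ᴴ * (T i * (T i)ᴴ)⁻¹)
    (hSS : ∀ i, IsUnit ((S i)ᴴ * S i))
    (hTT : ∀ i, IsUnit (T i * (T i)ᴴ)) (i : ℕ) :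
    ∃ C : Matrix (Fin k) (Fin k) ℂ, IsUnit C ∧ S i = (A * Aᴴ) ^ i * S 0 * C := by
  induction i with
  | zero => exact ⟨1, isUnit_one, by simp⟩
  | succ i ih =>
    obtain ⟨C, hC, h⟩ := ih
    refine ⟨C * (((S i)ᴴ * S i)⁻¹)ᴴ * (T i * (T i)ᴴ)⁻¹, ?_, ?_⟩
    · exact (hC.mul (isUnit_nonsing_inv_iff.mpr (hSS i)).star).mul
        (isUnit_nonsing_inv_iff.mpr (hTT i))
    · have hTH : (T i)ᴴ = Aᴴ * (S i * (((S i)ᴴ * S i)⁻¹)ᴴ) := by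
        conv_lhs => rw [hT i]
        simp only [conjTranspose_mul, conjTranspose_conjTranspose]
      calc S (i + 1) = A * (T i)ᴴ * (T i * (T i)ᴴ)⁻¹ := hS i
        _ = A * Aᴴ * S i * (((S i)ᴴ * S i)⁻¹)ᴴ * (T i * (T i)ᴴ)⁻¹ := by
          congr 1
          rw [hTH]
          simp only [Matrix.mul_assoc]
        _ = A * Aᴴ * ((A * Aᴴ) ^ i * S 0 * C) * (((S i)ᴴ * S i)⁻¹)ᴴ * (T i * (T i)ᴴ)⁻¹ := by
          rw [← h]
        _ = _ := by simp only [pow_succ', Matrix.mul_assoc]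

theorem als_column_space_and_rank {m n k : ℕ}
    (A : Matrix (Fin m) (Fin n) ℂ)
    (S : ℕ → Matrix (Fin m) (Fin k) ℂ) (T : ℕ → Matrix (Fin k) (Fin n) ℂ)
    (hT : ∀ i, T i = ((S i)ᴴ * S i)⁻¹ * (S i)ᴴ * A)
    (hS : ∀ i, S (i + 1) = A * (T i)ᴴ * (T i * (T i)ᴴ)⁻¹)
    (hSS : ∀ i, IsUnit ((S i)ᴴ * S i))
    (hTT : ∀ i, IsUnit (T i * (T i)ᴴ))
    (hSA : ∀ i, IsUnit ((S i)ᴴ * A * Aᴴ * S i)) :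
    ∀ i, 1 ≤ i →
      LinearMap.range (S i).mulVecLin ≤
          LinearMap.range ((A * Aᴴ) ^ i * S 0).mulVecLin ∧
        (S i).rank = ((A * Aᴴ) ^ i * S 0).rank := by
  intro i _
  obtain ⟨C, hC, h⟩ := als_exists_isUnit_right_factor A S T hT hS hSS hTT i
  rw [h]
  refine ⟨?_, rank_mul_eq_left_of_isUnit_det _ _ ((isUnit_iff_isUnit_det C).mp hC)⟩
  rw [mulVecLin_mul]
  exact LinearMap.range_comp_le_range _ _
end
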